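/- Let H be a finite-dimensional complex inner product space, E an orthogonal projection, and R₀, R₁, …, R_m Hermitian operators with R_iE = R_i for all i. A family D₀°, …, D_m° with D_i° ≥ 0 and Σ_{i=0}^m D_i° = E attains the supremum of Σ_{i=0}^m Tr(R_iD_i) over all such families if and only if there exists a Hermitian operator L° with L° ≥ R_i for all i = 0, …, m such that (L° − R_i)D_i° = 0 for all i. The operator L° then attains the infimum of Tr(LE) over all Hermitian L with L ≥ R_i for all i, the same conditions are necessary and sufficient for dual optimality of L°, and the optimal values coincide: sup Σ_i Tr(R_iD_i) = inf{Tr(LE) : L ≥ R_i ∀i}. -/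

import Mathlib

open Matrix
open scoped ComplexOrder

open scoped MatrixOrder in
lemma aux_factor {n : ℕ} {A : Matrix (Fin n) (Fin n) ℂ} (hA : A.PosSemidef) :
    ∃ X : Matrix (Fin n) (Fin n) ℂ, A = Xᴴ * X :=
  CStarAlgebra.nonneg_iff_eq_star_mul_self.1 hA.nonneg

lemma aux_trace_psd {n : ℕ} {A D : Matrix (Fin n) (Fin n) ℂ}
    (hA : A.PosSemidef) (hD : D.PosSemidef) :
    0 ≤ ((A * D).trace).re ∧ (((A * D).trace).re = 0 → A * D = 0) := by
  obtain ⟨X, rfl⟩ := aux_factor hA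
  obtain ⟨Y, rfl⟩ := aux_factor hD
  have key : ((Xᴴ * X) * (Yᴴ * Y)).trace = ((X * Yᴴ)ᴴ * (X * Yᴴ)).trace := by
    rw [Matrix.conjTranspose_mul, Matrix.conjTranspose_conjTranspose, ← Matrix.mul_assoc,
      Matrix.trace_mul_comm]
    simp only [Matrix.mul_assoc]
  have hnn := (Matrix.posSemidef_conjTranspose_mul_self (X * Yᴴ)).trace_nonneg
  rw [key]
  rw [Complex.nonneg_iff] at hnn
  refine ⟨hnn.1, fun h => ?_⟩
  have h0 : ((X * Yᴴ)ᴴ * (X * Yᴴ)).trace = 0 := Complex.ext h hnn.2.symm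
  have hZ := Matrix.trace_conjTranspose_mul_self_eq_zero_iff.1 h0
  have : (Xᴴ * X) * (Yᴴ * Y) = Xᴴ * (X * Yᴴ) * Y := by simp only [Matrix.mul_assoc]
  rw [this, hZ]; simp

lemma aux_gap {n m : ℕ} {E : Matrix (Fin n) (Fin n) ℂ}
    (R D : Fin (m + 1) → Matrix (Fin n) (Fin n) ℂ) (L : Matrix (Fin n) (Fin n) ℂ)
    (hs : ∑ i, D i = E) :
    ∑ i, (((L - R i) * D i).trace).re
      = ((L * E).trace).re - ∑ i, ((R i * D i).trace).re := by
  subst hs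
  simp [Matrix.sub_mul, Finset.mul_sum, Matrix.trace_sum, Finset.sum_sub_distrib]

lemma aux_zero {n m : ℕ} {E : Matrix (Fin n) (Fin n) ℂ}
    (R D : Fin (m + 1) → Matrix (Fin n) (Fin n) ℂ) (L : Matrix (Fin n) (Fin n) ℂ)
    (hs : ∑ i, D i = E) (hD : ∀ i, (D i).PosSemidef) (hL : ∀ i, (L - R i).PosSemidef)
    (h : ((L * E).trace).re = ∑ i, ((R i * D i).trace).re) :
    ∀ i, (L - R i) * D i = 0 := by
  have hg := aux_gap R D L hs
  rw [h, sub_self] at hg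
  rw [Finset.sum_eq_zero_iff_of_nonneg (fun i _ => (aux_trace_psd (hL i) (hD i)).1)] at hg
  exact fun i => (aux_trace_psd (hL i) (hD i)).2 (hg i (Finset.mem_univ i))

lemma aux_weak {n m : ℕ} {E : Matrix (Fin n) (Fin n) ℂ}
    (R D : Fin (m + 1) → Matrix (Fin n) (Fin n) ℂ) (L : Matrix (Fin n) (Fin n) ℂ)
    (hs : ∑ i, D i = E) (hD : ∀ i, (D i).PosSemidef) (hL : ∀ i, (L - R i).PosSemidef) :
    ∑ i, ((R i * D i).trace).re ≤ ((L * E).trace).re := by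
  have hg := aux_gap R D L hs
  have : 0 ≤ ∑ i, (((L - R i) * D i).trace).re :=
    Finset.sum_nonneg fun i _ => (aux_trace_psd (hL i) (hD i)).1
  linarith

lemma aux_eq {n m : ℕ} {E : Matrix (Fin n) (Fin n) ℂ}
    (R D : Fin (m + 1) → Matrix (Fin n) (Fin n) ℂ) (L : Matrix (Fin n) (Fin n) ℂ)
    (hs : ∑ i, D i = E) (h : ∀ i, (L - R i) * D i = 0) :
    ((L * E).trace).re = ∑ i, ((R i * D i).trace).re := by
  have hg := aux_gap R D L hs
  simp [h] at hg
  linarith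

lemma aux_exists {n m : ℕ} (E : Matrix (Fin n) (Fin n) ℂ)
    (R : Fin (m + 1) → Matrix (Fin n) (Fin n) ℂ)
    (hE : E.IsHermitian) (hEproj : E * E = E) :
    ∃ D₀ : Fin (m + 1) → Matrix (Fin n) (Fin n) ℂ, (∀ i, (D₀ i).PosSemidef) ∧ ∑ i, D₀ i = E ∧
      ∀ D : Fin (m + 1) → Matrix (Fin n) (Fin n) ℂ,
          (∀ i, (D i).PosSemidef) → ∑ i, D i = E →
          ∑ i, ((R i * D i).trace).re ≤ ∑ i, ((R i * D₀ i).trace).re := by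
  let K : Set (Fin (m + 1) → Matrix (Fin n) (Fin n) ℂ) := {B | ∑ i, (B i)ᴴ * B i = E}
  let C : Set (Fin (m + 1) → Matrix (Fin n) (Fin n) ℂ) :=
    Set.univ.pi fun _ => (Set.univ.pi fun _ => Set.univ.pi fun _ =>
      Metric.closedBall (0 : ℂ) (Real.sqrt (E.trace).re) : Set (Fin n → Fin n → ℂ))
  have hC : IsCompact C := isCompact_univ_pi fun _ => isCompact_univ_pi fun _ =>
    isCompact_univ_pi fun _ => isCompact_closedBall _ _
  have hKc : IsClosed K := isClosed_eq (by fun_prop) continuous_const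
  have hKC : K ⊆ C := by
    intro B hB i _ k _ l _
    have h1 : (E.trace).re = ∑ i, ∑ l, ∑ k, ‖B i k l‖ ^ 2 := by
      rw [← (show ∑ i, (B i)ᴴ * B i = E from hB)]
      rw [Matrix.trace_sum]
      simp [Matrix.trace, Matrix.mul_apply, ← Complex.normSq_eq_norm_sq,
        Complex.normSq_apply]
    have h2 : ‖B i k l‖ ^ 2 ≤ (E.trace).re := by
      rw [h1]
      refine le_trans ?_ (Finset.single_le_sum
        (f := fun i => ∑ l, ∑ k, ‖B i k l‖ ^ 2) (fun _ _ => by positivity) (Finset.mem_univ i))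
      refine le_trans ?_ (Finset.single_le_sum
        (f := fun l => ∑ k, ‖B i k l‖ ^ 2) (fun _ _ => by positivity) (Finset.mem_univ l))
      exact Finset.single_le_sum
        (f := fun k => ‖B i k l‖ ^ 2) (fun _ _ => by positivity) (Finset.mem_univ k)
    rw [mem_closedBall_zero_iff]
    exact Real.le_sqrt_of_sq_le h2
  have hK : IsCompact K := hC.of_isClosed_subset hKc hKC
  have hne : K.Nonempty := by
    refine ⟨Pi.single 0 E, ?_⟩
    show ∑ i, _ = E
    rw [Finset.sum_eq_single 0]
    · simp [hE.eq, hEproj]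
    · intro b _ hb
      simp [Pi.single_eq_of_ne hb]
    · simp
  have hcont : Continuous fun B : Fin (m + 1) → Matrix (Fin n) (Fin n) ℂ =>
      ∑ i, ((R i * ((B i)ᴴ * B i)).trace).re := by
    refine continuous_finsetSum _ fun i _ => Complex.continuous_re.comp ?_
    exact Continuous.matrix_trace (by fun_prop)
  obtain ⟨B, hB, hmax⟩ := hK.exists_isMaxOn hne hcont.continuousOn
  refine ⟨fun i => (B i)ᴴ * B i, fun i => Matrix.posSemidef_conjTranspose_mul_self _, hB, ?_⟩
  intro D hD hs
  choose Y hY using fun i => aux_factor (hD i)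
  have hYK : Y ∈ K := by
    show ∑ i, _ = E
    rw [← hs]
    exact Finset.sum_congr rfl fun i _ => (hY i).symm
  have := hmax hYK
  simp only [Set.mem_setOf_eq, ← hY] at this
  exact this

lemma aux_quad {a b δ : ℝ} (hδ : 0 < δ)
    (h : ∀ ε, 0 < ε → ε ≤ δ → ε * a + ε ^ 2 * b ≤ 0) : a ≤ 0 := by
  by_contra! ha
  have hb : 0 < |b| + 1 := by positivity
  set ε := min δ (a / (|b| + 1) / 2) with hε
  have h0 : 0 < ε := lt_min hδ (by positivity)
  have h1 := h ε h0 (min_le_left _ _)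
  have h2 : ε * (|b| + 1) ≤ a / 2 := by
    have : ε ≤ a / (|b| + 1) / 2 := min_le_right _ _
    calc ε * (|b| + 1) ≤ (a / (|b| + 1) / 2) * (|b| + 1) := by gcongr
      _ = a / 2 := by field_simp
  have h3 : a + ε * b ≤ 0 := by
    by_contra! hc
    nlinarith
  nlinarith [neg_abs_le b]

lemma aux_variation {n m : ℕ} (E : Matrix (Fin n) (Fin n) ℂ)
    (R : Fin (m + 1) → Matrix (Fin n) (Fin n) ℂ)
    (hR : ∀ i, (R i).IsHermitian)
    (D₀ : Fin (m + 1) → Matrix (Fin n) (Fin n) ℂ) (hD : ∀ i, (D₀ i).PosSemidef)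
    (hs : ∑ i, D₀ i = E)
    (hopt : ∀ D : Fin (m + 1) → Matrix (Fin n) (Fin n) ℂ,
          (∀ i, (D i).PosSemidef) → ∑ i, D i = E →
          ∑ i, ((R i * D i).trace).re ≤ ∑ i, ((R i * D₀ i).trace).re)
    (P : Matrix (Fin n) (Fin n) ℂ) (hP : P.PosSemidef) (hEP : E * P = P) (hPE : P * E = P)
    (c : ℝ) (hc : 0 ≤ c) (hPP : P * P = (c : ℂ) • P) (i : Fin (m + 1)) :
    ((R i * P).trace).re ≤ (((∑ j, R j * D₀ j) * P).trace).re := by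
  have hswap : ∀ j, ((R j * (P * D₀ j)).trace).re = ((R j * D₀ j * P).trace).re := by
    intro j
    have h1 : (R j * (P * D₀ j))ᴴ = D₀ j * P * R j := by
      rw [Matrix.conjTranspose_mul, Matrix.conjTranspose_mul, (hR j).eq, hP.1.eq, (hD j).1.eq]
    have h2 : ((R j * (P * D₀ j)).trace).re = (((R j * (P * D₀ j))ᴴ).trace).re := by
      rw [Matrix.trace_conjTranspose]; simp
    rw [h2, h1, Matrix.trace_mul_comm, Matrix.mul_assoc]
  suffices h : 2 * ((R i * P).trace).re - 2 * (((∑ j, R j * D₀ j) * P).trace).re ≤ 0 by linarith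
  refine aux_quad (b := ∑ j, ((R j * (P * D₀ j * P)).trace).re - c * ((R i * P).trace).re)
    (δ := 2 / (c + 1)) (by positivity) ?_
  intro ε hε hεδ
  have hcoef : 0 ≤ 2 * ε - ε ^ 2 * c := by
    have : ε * (c + 1) ≤ 2 := by rwa [le_div_iff₀ (by positivity)] at hεδ
    nlinarith
  let T : Matrix (Fin n) (Fin n) ℂ := 1 - (ε : ℂ) • P
  have hT : Tᴴ = T := by
    simp [T, Matrix.conjTranspose_smul, hP.1.eq]
  let X : Fin (m + 1) → Matrix (Fin n) (Fin n) ℂ :=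
    Pi.single i (((2 * ε - ε ^ 2 * c : ℝ) : ℂ) • P)
  have hexp : ∀ A : Matrix (Fin n) (Fin n) ℂ, T * A * T =
      A - (ε : ℂ) • (P * A) - (ε : ℂ) • (A * P) + ((ε : ℂ) ^ 2) • (P * A * P) := by
    intro A
    simp only [T, Matrix.sub_mul, Matrix.mul_sub, Matrix.one_mul, Matrix.mul_one,
      Matrix.smul_mul, Matrix.mul_smul, smul_sub, smul_smul, pow_two]
    abel
  have hpsd : ∀ j, (T * D₀ j * T + X j).PosSemidef := by
    intro j
    refine Matrix.PosSemidef.add ?_ ?_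
    · have := (hD j).mul_mul_conjTranspose_same T
      rwa [hT] at this
    · by_cases hj : j = i
      · subst hj
        simp only [X, Pi.single_eq_same]
        exact hP.smul (by exact_mod_cast hcoef)
      · simp only [X, Pi.single_eq_of_ne hj]
        exact Matrix.PosSemidef.zero
  have hsum : ∑ j, (T * D₀ j * T + X j) = E := by
    rw [Finset.sum_add_distrib, ← Finset.sum_mul, ← Finset.mul_sum, hs, hexp, hPE, hEP, hPP]
    simp only [X, Finset.sum_pi_single', Finset.mem_univ, if_true]
    push_cast
    module
  have h := hopt _ hpsd hsum
  have hX : ∑ j, ((R j * X j).trace).re = (2 * ε - ε ^ 2 * c) * ((R i * P).trace).re := by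
    rw [Finset.sum_eq_single i]
    · simp only [X, Pi.single_eq_same, Matrix.mul_smul, Matrix.trace_smul, smul_eq_mul,
        Complex.re_ofReal_mul]
    · intro j _ hj
      simp [X, Pi.single_eq_of_ne hj]
    · simp
  have hj : ∀ j, ((R j * (T * D₀ j * T)).trace).re = ((R j * D₀ j).trace).re
      - 2 * ε * ((R j * D₀ j * P).trace).re + ε ^ 2 * ((R j * (P * D₀ j * P)).trace).re := by
    intro j
    rw [hexp]
    simp only [Matrix.mul_add, Matrix.mul_sub, Matrix.mul_smul, Matrix.trace_add,
      Matrix.trace_sub, Matrix.trace_smul, smul_eq_mul, Complex.add_re, Complex.sub_re,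
      ← Complex.ofReal_pow, Complex.re_ofReal_mul]
    rw [hswap, ← Matrix.mul_assoc (R j) (D₀ j) P]
    ring
  simp only [Matrix.mul_add, Matrix.trace_add, Complex.add_re, Finset.sum_add_distrib, hj, hX,
    Finset.sum_sub_distrib, ← Finset.mul_sum] at h
  rw [Finset.sum_mul, Matrix.trace_sum, Complex.re_sum]
  linarith

lemma aux_dual {n m : ℕ} (E : Matrix (Fin n) (Fin n) ℂ)
    (R : Fin (m + 1) → Matrix (Fin n) (Fin n) ℂ)
    (hE : E.IsHermitian) (hEproj : E * E = E)
    (hR : ∀ i, (R i).IsHermitian) (hRE : ∀ i, R i * E = R i)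
    (D₀ : Fin (m + 1) → Matrix (Fin n) (Fin n) ℂ) (hD : ∀ i, (D₀ i).PosSemidef)
    (hs : ∑ i, D₀ i = E)
    (hopt : ∀ D : Fin (m + 1) → Matrix (Fin n) (Fin n) ℂ,
          (∀ i, (D i).PosSemidef) → ∑ i, D i = E →
          ∑ i, ((R i * D i).trace).re ≤ ∑ i, ((R i * D₀ i).trace).re) :
    ∃ L₀ : Matrix (Fin n) (Fin n) ℂ, L₀.IsHermitian ∧
          (∀ i, (L₀ - R i).PosSemidef) ∧ ∀ i, (L₀ - R i) * D₀ i = 0 := by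
  have hER : ∀ i, E * R i = R i := by
    intro i
    have := congrArg Matrix.conjTranspose (hRE i)
    rwa [Matrix.conjTranspose_mul, (hR i).eq, hE.eq] at this
  set L := ∑ j, R j * D₀ j with hL
  let S : Matrix (Fin n) (Fin n) ℂ := ((1 / 2 : ℝ) : ℂ) • (L + Lᴴ)
  have hSH : Sᴴ = S := by
    simp only [S, Matrix.conjTranspose_smul, Matrix.conjTranspose_add,
      Matrix.conjTranspose_conjTranspose, Complex.star_def, Complex.conj_ofReal]
    rw [add_comm]
  have hStr : ∀ Q : Matrix (Fin n) (Fin n) ℂ, Qᴴ = Q →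
      ((S * Q).trace).re = ((L * Q).trace).re := by
    intro Q hQ
    have h1 : ((Lᴴ * Q).trace).re = ((L * Q).trace).re := by
      have : Lᴴ * Q = (Q * L)ᴴ := by rw [Matrix.conjTranspose_mul, hQ]
      rw [this, Matrix.trace_conjTranspose, Matrix.trace_mul_comm]
      simp
    simp only [S, Matrix.smul_mul, Matrix.trace_smul, smul_eq_mul, Complex.re_ofReal_mul,
      Matrix.add_mul, Matrix.trace_add, Complex.add_re, h1]
    ring
  have hΛ : (E * S * E)ᴴ = E * S * E := by
    rw [Matrix.conjTranspose_mul, Matrix.conjTranspose_mul, hSH, hE.eq, Matrix.mul_assoc]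
  have hpsd : ∀ i, (E * S * E - R i).PosSemidef := by
    intro i
    have hH : (E * S * E - R i).IsHermitian := Matrix.IsHermitian.sub hΛ (hR i)
    refine Matrix.PosSemidef.of_dotProduct_mulVec_nonneg hH fun v => ?_
    set P := E * vecMulVec v (star v) * E with hP
    have hPpsd : P.PosSemidef := by
      have := (Matrix.posSemidef_vecMulVec_self_star v).mul_mul_conjTranspose_same E
      rwa [hE.eq] at this
    have hEP : E * P = P := by rw [hP, ← Matrix.mul_assoc, ← Matrix.mul_assoc, hEproj]
    have hPE : P * E = P := by rw [hP, Matrix.mul_assoc, hEproj]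
    have hEpsd : E.PosSemidef := by
      have := Matrix.posSemidef_conjTranspose_mul_self E
      rwa [hE.eq, hEproj] at this
    have hq := Complex.nonneg_iff.1 (hEpsd.dotProduct_mulVec_nonneg v)
    have hPP : P * P = (((star v ⬝ᵥ E *ᵥ v).re : ℝ) : ℂ) • P := by
      have h1 : (((star v ⬝ᵥ E *ᵥ v).re : ℝ) : ℂ) = star v ⬝ᵥ E *ᵥ v :=
        Complex.ext (by simp) (by simpa using hq.2)
      have h2 : vecMulVec v (star v) * E * vecMulVec v (star v)
          = (star v ⬝ᵥ E *ᵥ v) • vecMulVec v (star v) := by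
        rw [Matrix.mul_assoc, Matrix.mul_vecMulVec, Matrix.vecMulVec_mul_vecMulVec]
        simp [Matrix.vecMulVec_smul]
      have h3 : P * P = E * (vecMulVec v (star v) * E * vecMulVec v (star v)) * E := by
        calc P * P = E * vecMulVec v (star v) * (E * E) * vecMulVec v (star v) * E := by
              simp only [hP, Matrix.mul_assoc]
          _ = _ := by rw [hEproj]; simp only [Matrix.mul_assoc]
      rw [h1, h3, h2]
      simp [hP]
    have hvar := aux_variation E R hR D₀ hD hs hopt P hPpsd hEP hPE _ hq.1 hPP i
    rw [← hL, ← hStr P hPpsd.1.eq] at hvar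
    have hval : star v ⬝ᵥ (E * S * E - R i) *ᵥ v = (S * P).trace - (R i * P).trace := by
      have h1 : star v ⬝ᵥ (E * S * E - R i) *ᵥ v
          = ((E * S * E - R i) * vecMulVec v (star v)).trace := by
        rw [Matrix.mul_vecMulVec, Matrix.trace_vecMulVec, dotProduct_comm]
      have h2 : R i = E * R i * E := by rw [hER, hRE]
      have h3 : ∀ A : Matrix (Fin n) (Fin n) ℂ,
          (E * A * E * vecMulVec v (star v)).trace = (A * P).trace := by
        intro A
        rw [hP, Matrix.mul_assoc, Matrix.mul_assoc, Matrix.trace_mul_comm]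
        simp only [Matrix.mul_assoc]
      rw [h1, Matrix.sub_mul, Matrix.trace_sub, h3]
      nth_rewrite 1 [h2]
      rw [h3]
    have him := hH.im_star_dotProduct_mulVec_self v
    refine Complex.nonneg_iff.2 ⟨?_, him.symm⟩
    rw [hval, Complex.sub_re]
    linarith
  refine ⟨E * S * E, hΛ, hpsd, aux_zero R D₀ _ hs hD hpsd ?_⟩
  have h1 : (E * S * E * E).trace = (S * E).trace := by
    rw [Matrix.mul_assoc, hEproj, Matrix.mul_assoc, Matrix.trace_mul_comm, Matrix.mul_assoc, hEproj]
  rw [h1, hStr E hE.eq, hL, Finset.sum_mul, Matrix.trace_sum, Complex.re_sum]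
  refine Finset.sum_congr rfl fun j _ => ?_
  rw [Matrix.trace_mul_comm, ← Matrix.mul_assoc, hER]

/-- **Theorem 2.3.1** (optimality criterion for testing `m+1` wave hypotheses).
A complete resolving family `D₀ᵢ ≥ 0`, `∑ᵢ D₀ᵢ = E`, maximizes `∑ᵢ Tr (Rᵢ Dᵢ)` iff there
is a Hermitian `L₀ ≥ Rᵢ` (all `i`) with `(L₀ − Rᵢ) D₀ᵢ = 0` for all `i`; such `L₀`
minimizes `Tr (L E)` over Hermitian `L ≥ Rᵢ`, the same conditions characterize dual
optimality, and `sup ∑ᵢ Tr (Rᵢ Dᵢ) = inf {Tr (L E) : L ≥ Rᵢ ∀i}`. -/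
theorem hypothesis_testing_criterion {n m : ℕ}
    (E : Matrix (Fin n) (Fin n) ℂ) (R : Fin (m + 1) → Matrix (Fin n) (Fin n) ℂ)
    (hE : E.IsHermitian) (hEproj : E * E = E)
    (hR : ∀ i, (R i).IsHermitian) (hRE : ∀ i, R i * E = R i) :
    (∀ D₀ : Fin (m + 1) → Matrix (Fin n) (Fin n) ℂ,
      (∀ i, (D₀ i).PosSemidef) → ∑ i, D₀ i = E →
      ((∀ D : Fin (m + 1) → Matrix (Fin n) (Fin n) ℂ,
          (∀ i, (D i).PosSemidef) → ∑ i, D i = E →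
          ∑ i, ((R i * D i).trace).re ≤ ∑ i, ((R i * D₀ i).trace).re) ↔
        (∃ L₀ : Matrix (Fin n) (Fin n) ℂ, L₀.IsHermitian ∧
          (∀ i, (L₀ - R i).PosSemidef) ∧ ∀ i, (L₀ - R i) * D₀ i = 0))) ∧
    (∀ (D₀ : Fin (m + 1) → Matrix (Fin n) (Fin n) ℂ) (L₀ : Matrix (Fin n) (Fin n) ℂ),
      (∀ i, (D₀ i).PosSemidef) → ∑ i, D₀ i = E →
      L₀.IsHermitian → (∀ i, (L₀ - R i).PosSemidef) → (∀ i, (L₀ - R i) * D₀ i = 0) →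
      ∀ L : Matrix (Fin n) (Fin n) ℂ, L.IsHermitian → (∀ i, (L - R i).PosSemidef) →
        ((L₀ * E).trace).re ≤ ((L * E).trace).re) ∧
    (∀ L₀ : Matrix (Fin n) (Fin n) ℂ, L₀.IsHermitian → (∀ i, (L₀ - R i).PosSemidef) →
      ((∀ L : Matrix (Fin n) (Fin n) ℂ, L.IsHermitian → (∀ i, (L - R i).PosSemidef) →
          ((L₀ * E).trace).re ≤ ((L * E).trace).re) ↔
        (∃ D₀ : Fin (m + 1) → Matrix (Fin n) (Fin n) ℂ, (∀ i, (D₀ i).PosSemidef) ∧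
          ∑ i, D₀ i = E ∧ ∀ i, (L₀ - R i) * D₀ i = 0))) ∧
    sSup {t : ℝ | ∃ D : Fin (m + 1) → Matrix (Fin n) (Fin n) ℂ,
        (∀ i, (D i).PosSemidef) ∧ ∑ i, D i = E ∧
        t = ∑ i, ((R i * D i).trace).re} =
      sInf {t : ℝ | ∃ L : Matrix (Fin n) (Fin n) ℂ,
        L.IsHermitian ∧ (∀ i, (L - R i).PosSemidef) ∧ t = ((L * E).trace).re} := by
  obtain ⟨D₁, hD₁, hs₁, hopt₁⟩ := aux_exists E R hE hEproj
  obtain ⟨L₁, hL₁H, hL₁, hz₁⟩ := aux_dual E R hE hEproj hR hRE D₁ hD₁ hs₁ hopt₁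
  have he₁ := aux_eq R D₁ L₁ hs₁ hz₁
  refine ⟨?_, ?_, ?_, ?_⟩
  · intro D₀ hD hs
    refine ⟨aux_dual E R hE hEproj hR hRE D₀ hD hs, ?_⟩
    rintro ⟨L, _, hL, hz⟩ D hD' hs'
    rw [← aux_eq R D₀ L hs hz]
    exact aux_weak R D L hs' hD' hL
  · intro D₀ L₀ hD hs _ _ hz L _ hL
    rw [aux_eq R D₀ L₀ hs hz]
    exact aux_weak R D₀ L hs hD hL
  · intro L₀ _ hL₀
    constructor
    · intro hmin
      refine ⟨D₁, hD₁, hs₁, aux_zero R D₁ L₀ hs₁ hD₁ hL₀ (le_antisymm ?_ ?_)⟩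
      · rw [← he₁]
        exact hmin L₁ hL₁H hL₁
      · exact aux_weak R D₁ L₀ hs₁ hD₁ hL₀
    · rintro ⟨D₀, hD, hs, hz⟩ L _ hL
      rw [aux_eq R D₀ L₀ hs hz]
      exact aux_weak R D₀ L hs hD hL
  · have hg : IsGreatest {t : ℝ | ∃ D : Fin (m + 1) → Matrix (Fin n) (Fin n) ℂ,
        (∀ i, (D i).PosSemidef) ∧ ∑ i, D i = E ∧
        t = ∑ i, ((R i * D i).trace).re} (∑ i, ((R i * D₁ i).trace).re) := by
      refine ⟨⟨D₁, hD₁, hs₁, rfl⟩, ?_⟩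
      rintro t ⟨D, hD, hs, rfl⟩
      exact hopt₁ D hD hs
    have hl : IsLeast {t : ℝ | ∃ L : Matrix (Fin n) (Fin n) ℂ,
        L.IsHermitian ∧ (∀ i, (L - R i).PosSemidef) ∧ t = ((L * E).trace).re}
        (∑ i, ((R i * D₁ i).trace).re) := by
      refine ⟨⟨L₁, hL₁H, hL₁, he₁.symm⟩, ?_⟩
      rintro t ⟨L, _, hL, rfl⟩
      exact aux_weak R D₁ L hs₁ hD₁ hL
    rw [hg.csSup_eq, hl.csInf_eq]
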